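/- arXiv:2211.13211 — 5 statements merged into one kernel-verified Lean document; each statement's English description precedes it below -/
import Mathlib

section
/- Let X be a real random variable with mean zero and finite variance σ² > 0, and let X* have the zero bias distribution of X. Then the law of X* is absolutely continuous with respect to Lebesgue measure, with density f_{X*}(t) = (1/σ²) E[X · 1_{X > t}], and moreover (1/σ²) E[X · 1_{X > t}] = −(1/σ²) E[X · 1_{X ≤ t}] for every t ∈ ℝ. -/
open MeasureTheory

/-- `Xs` has the zero bias distribution of `X` (mean zero, variance `σ2`):
`E[X f(X)] = σ2 E[f'(Xs)]` for every absolutely continuous `f` (formalized as a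
differentiable function with derivative `f'`) for which both expectations exist. -/
def IsZeroBias {Ω : Type*} [MeasurableSpace Ω] (P : Measure Ω)
    (X Xs : Ω → ℝ) (σ2 : ℝ) : Prop :=
  ∀ f f' : ℝ → ℝ, (∀ x, HasDerivAt f (f' x) x) →
    Integrable (fun ω => X ω * f (X ω)) P →
    Integrable (fun ω => f' (Xs ω)) P →
    ∫ ω, X ω * f (X ω) ∂P = σ2 * ∫ ω, f' (Xs ω) ∂P

open scoped NNReal BoundedContinuousFunction

/-- The kernel `x (1_{t < x} - 1_{t < 0})`, whose integral against `g` over `t` is `x ∫₀ˣ g`. -/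
noncomputable def zeroBiasKernel (x t : ℝ) : ℝ :=
  (if t < x then x else 0) - (if t < 0 then x else 0)

lemma zeroBiasKernel_nonneg (x t : ℝ) : 0 ≤ zeroBiasKernel x t := by
  unfold zeroBiasKernel
  split_ifs <;> linarith

lemma measurable_zeroBiasKernel : Measurable (Function.uncurry zeroBiasKernel) := by
  unfold zeroBiasKernel Function.uncurry
  refine Measurable.sub ?_ ?_
  · exact Measurable.ite (measurableSet_lt measurable_snd measurable_fst)
      measurable_fst measurable_const
  · exact Measurable.ite (measurableSet_lt measurable_snd measurable_const)
      measurable_fst measurable_const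

lemma lintegral_zeroBiasKernel_mul (g : ℝ →ᵇ ℝ≥0) (x : ℝ) :
    ∫⁻ t, ENNReal.ofReal (zeroBiasKernel x t) * g t
      = ENNReal.ofReal (x * ∫ t in (0 : ℝ)..x, (g t : ℝ)) := by
  have hg : Continuous fun t => (g t : ℝ) := by fun_prop
  rcases le_or_gt 0 x with hx | hx
  · have hker : ∀ t, ENNReal.ofReal (zeroBiasKernel x t) * g t
        = (Set.Ico 0 x).indicator (fun t => ENNReal.ofReal (x * g t)) t := by
      intro t
      simp_rw [ENNReal.ofReal_mul hx, ENNReal.ofReal_coe_nnreal]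
      by_cases h₁ : t < x <;> by_cases h₂ : t < 0 <;>
        simp [zeroBiasKernel, Set.indicator, h₁, h₂, not_lt.mp]
      linarith
    simp_rw [hker]
    rw [lintegral_indicator measurableSet_Ico, ← intervalIntegral.integral_const_mul,
      intervalIntegral.integral_of_le hx, ← integral_Ico_eq_integral_Ioc,
      ofReal_integral_eq_lintegral_ofReal]
    · exact ((hg.const_mul x).integrableOn_Icc (a := 0) (b := x)).mono_set Set.Ico_subset_Icc_self
    · exact Filter.Eventually.of_forall fun t => mul_nonneg hx (g t).2
  · have hker : ∀ t, ENNReal.ofReal (zeroBiasKernel x t) * g t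
        = (Set.Ico x 0).indicator (fun t => ENNReal.ofReal (-x * g t)) t := by
      intro t
      simp_rw [ENNReal.ofReal_mul (neg_nonneg.mpr hx.le), ENNReal.ofReal_coe_nnreal]
      by_cases h₁ : t < x <;> by_cases h₂ : t < 0 <;>
        simp [zeroBiasKernel, Set.indicator, h₁, h₂, not_lt.mp]
      linarith
    simp_rw [hker]
    rw [lintegral_indicator measurableSet_Ico, intervalIntegral.integral_symm, mul_neg, ← neg_mul,
      ← intervalIntegral.integral_const_mul,
      intervalIntegral.integral_of_le hx.le, ← integral_Ico_eq_integral_Ioc,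
      ofReal_integral_eq_lintegral_ofReal]
    · exact ((hg.const_mul (-x)).integrableOn_Icc (a := x) (b := 0)).mono_set
        Set.Ico_subset_Icc_self
    · exact Filter.Eventually.of_forall fun t => mul_nonneg (by linarith) (g t).2

section

variable {Ω : Type*} [MeasurableSpace Ω] {P : Measure Ω} {X Xs : Ω → ℝ} {σ2 : ℝ}

lemma ofReal_integral_indicator_lt_eq_lintegral_zeroBiasKernel
    (hX : Measurable X) (hint : Integrable X P) (hmean : ∫ ω, X ω ∂P = 0) (t : ℝ) :
    ENNReal.ofReal (∫ ω, Set.indicator {ω' | t < X ω'} X ω ∂P)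
      = ∫⁻ ω, ENNReal.ofReal (zeroBiasKernel (X ω) t) ∂P := by
  have hind : Integrable (Set.indicator {ω' | t < X ω'} X) P :=
    hint.indicator (measurableSet_lt measurable_const hX)
  have hite : Integrable (fun ω => if t < 0 then X ω else 0) P := by
    split_ifs
    exacts [hint, integrable_zero _ _ _]
  have hzero : ∫ ω, (if t < 0 then X ω else 0) ∂P = 0 := by
    split_ifs
    exacts [hmean, integral_zero _ _]
  have hker : (fun ω => zeroBiasKernel (X ω) t)
      = fun ω => Set.indicator {ω' | t < X ω'} X ω - (if t < 0 then X ω else 0) := by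
    ext ω
    simp [zeroBiasKernel, Set.indicator]
  rw [← ofReal_integral_eq_lintegral_ofReal (hker ▸ hind.sub hite)
    (Filter.Eventually.of_forall fun ω => zeroBiasKernel_nonneg _ _), hker,
    integral_sub hind hite, hzero, sub_zero]

lemma lintegral_mul_ofReal_integral_indicator_lt [SFinite P]
    (hX : Measurable X) (hint : Integrable X P) (hmean : ∫ ω, X ω ∂P = 0) (g : ℝ →ᵇ ℝ≥0) :
    ∫⁻ t, ENNReal.ofReal (∫ ω, Set.indicator {ω' | t < X ω'} X ω ∂P) * g t
      = ∫⁻ ω, ENNReal.ofReal (X ω * ∫ t in (0 : ℝ)..X ω, (g t : ℝ)) ∂P := by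
  have hmeas : Measurable fun p : ℝ × Ω => ENNReal.ofReal (zeroBiasKernel (X p.2) p.1) :=
    (measurable_zeroBiasKernel.comp ((hX.comp measurable_snd).prodMk measurable_fst)).ennreal_ofReal
  have hg : Measurable fun t => (g t : ENNReal) := by fun_prop
  calc ∫⁻ t, ENNReal.ofReal (∫ ω, Set.indicator {ω' | t < X ω'} X ω ∂P) * g t
      = ∫⁻ t, ∫⁻ ω, ENNReal.ofReal (zeroBiasKernel (X ω) t) * g t ∂P := by
        refine lintegral_congr fun t => ?_
        rw [ofReal_integral_indicator_lt_eq_lintegral_zeroBiasKernel hX hint hmean,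
          lintegral_mul_const]
        exact hmeas.comp (measurable_const.prodMk measurable_id)
    _ = ∫⁻ ω, (∫⁻ t, ENNReal.ofReal (zeroBiasKernel (X ω) t) * g t) ∂P :=
        lintegral_lintegral_swap (hmeas.mul (hg.comp measurable_fst)).aemeasurable
    _ = _ := lintegral_congr fun ω => lintegral_zeroBiasKernel_mul g (X ω)

lemma measurable_ofReal_integral_indicator_lt [SFinite P]
    (hX : Measurable X) (hint : Integrable X P) (hmean : ∫ ω, X ω ∂P = 0) :
    Measurable fun t => ENNReal.ofReal (∫ ω, Set.indicator {ω' | t < X ω'} X ω ∂P) := by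
  simp_rw [ofReal_integral_indicator_lt_eq_lintegral_zeroBiasKernel hX hint hmean]
  exact Measurable.lintegral_prod_right' (f := fun p : ℝ × Ω =>
    ENNReal.ofReal (zeroBiasKernel (X p.2) p.1)) (measurable_zeroBiasKernel.comp
      ((hX.comp measurable_snd).prodMk measurable_fst)).ennreal_ofReal

lemma mul_intervalIntegral_zero_nonneg (g : ℝ →ᵇ ℝ≥0) (x : ℝ) :
    0 ≤ x * ∫ t in (0 : ℝ)..x, (g t : ℝ) := by
  rcases le_or_gt 0 x with hx | hx
  · exact mul_nonneg hx (intervalIntegral.integral_nonneg hx fun t _ => (g t).2)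
  · rw [intervalIntegral.integral_symm]
    have := intervalIntegral.integral_nonneg (μ := volume) hx.le fun t _ => (g t).2
    exact mul_nonneg_of_nonpos_of_nonpos hx.le (neg_nonpos.mpr this)

/-- The zero bias identity for the antiderivative of a bounded continuous function. -/
lemma IsZeroBias.lintegral_mul_intervalIntegral [IsFiniteMeasure P]
    (hzb : IsZeroBias P X Xs σ2) (hX : Measurable X) (hXs : Measurable Xs) (hσ2 : 0 ≤ σ2)
    (hsq : Integrable (fun ω => X ω ^ 2) P) (g : ℝ →ᵇ ℝ≥0) :
    ∫⁻ ω, ENNReal.ofReal (X ω * ∫ t in (0 : ℝ)..X ω, (g t : ℝ)) ∂P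
      = ENNReal.ofReal σ2 * ∫⁻ ω, g (Xs ω) ∂P := by
  have hg : Continuous fun t => (g t : ℝ) := by fun_prop
  have hbound : ∀ t, ‖(g t : ℝ)‖ ≤ nndist g 0 := fun t => by
    rw [NNReal.norm_eq]
    exact_mod_cast BoundedContinuousFunction.NNReal.upper_bound g t
  have hderiv : ∀ x, HasDerivAt (fun x => ∫ t in (0 : ℝ)..x, (g t : ℝ)) (g x) x :=
    fun x => hg.integral_hasStrictDerivAt 0 x |>.hasDerivAt
  have hcont : Continuous fun x => ∫ t in (0 : ℝ)..x, (g t : ℝ) :=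
    continuous_iff_continuousAt.mpr fun x => (hderiv x).continuousAt
  have hint₁ : Integrable (fun ω => X ω * ∫ t in (0 : ℝ)..X ω, (g t : ℝ)) P := by
    refine (hsq.const_mul (nndist g 0 : ℝ)).mono' (hX.mul (hcont.measurable.comp hX)).aestronglyMeasurable
      (Filter.Eventually.of_forall fun ω => ?_)
    have h := intervalIntegral.norm_integral_le_of_norm_le_const (a := 0) (b := X ω)
      fun t _ => hbound t
    rw [norm_mul, ← sq_abs, Real.norm_eq_abs]
    rw [sub_zero] at h
    nlinarith [mul_le_mul_of_nonneg_left h (abs_nonneg (X ω))]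
  have hint₂ : Integrable (fun ω => (g (Xs ω) : ℝ)) P :=
    Integrable.of_bound (hg.measurable.comp hXs).aestronglyMeasurable (nndist g 0)
      (Filter.Eventually.of_forall fun ω => hbound _)
  rw [← ofReal_integral_eq_lintegral_ofReal hint₁
    (Filter.Eventually.of_forall fun ω => mul_intervalIntegral_zero_nonneg g _),
    hzb _ _ hderiv hint₁ hint₂, ENNReal.ofReal_mul hσ2,
    ofReal_integral_eq_lintegral_ofReal hint₂ (Filter.Eventually.of_forall fun ω => (g _).2)]
  simp

end

/-- The zero bias distribution is absolutely continuous with respect to Lebesgue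
measure, with density `t ↦ σ2⁻¹ E[X 1_{X > t}]`, and this density also equals
`t ↦ -σ2⁻¹ E[X 1_{X ≤ t}]`. -/
theorem zeroBias_density {Ω : Type*} [MeasurableSpace Ω] (P : Measure Ω)
    [IsProbabilityMeasure P] (X Xs : Ω → ℝ) (hX : Measurable X) (hXs : Measurable Xs)
    (σ2 : ℝ) (hσ2 : 0 < σ2) (hint : Integrable X P)
    (hmean : ∫ ω, X ω ∂P = 0) (hvar : ∫ ω, (X ω) ^ 2 ∂P = σ2)
    (hzb : IsZeroBias P X Xs σ2) :
    Measure.map Xs P =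
      volume.withDensity
        (fun t => ENNReal.ofReal (σ2⁻¹ * ∫ ω, Set.indicator {ω' | t < X ω'} X ω ∂P)) ∧
    ∀ t : ℝ,
      σ2⁻¹ * ∫ ω, Set.indicator {ω' | t < X ω'} X ω ∂P
        = -(σ2⁻¹ * ∫ ω, Set.indicator {ω' | X ω' ≤ t} X ω ∂P) := by
  have hsq : Integrable (fun ω => X ω ^ 2) P := by
    by_contra h
    rw [integral_undef h] at hvar
    exact hσ2.ne hvar
  constructor
  · have hmeas := measurable_ofReal_integral_indicator_lt hX hint hmean
    have key : ∀ g : ℝ →ᵇ ℝ≥0, ∫⁻ t, g t ∂Measure.map Xs P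
        = ∫⁻ t, g t ∂volume.withDensity
          (fun t => ENNReal.ofReal (σ2⁻¹ * ∫ ω, Set.indicator {ω' | t < X ω'} X ω ∂P)) := by
      intro g
      have hg : Measurable fun t => (g t : ENNReal) := by fun_prop
      simp_rw [ENNReal.ofReal_mul (inv_nonneg.mpr hσ2.le)]
      rw [lintegral_map hg hXs, lintegral_withDensity_eq_lintegral_mul _ (hmeas.const_mul _) hg]
      simp_rw [Pi.mul_apply, mul_assoc]
      rw [lintegral_const_mul _ (by exact hmeas.mul hg),
        lintegral_mul_ofReal_integral_indicator_lt hX hint hmean,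
        hzb.lintegral_mul_intervalIntegral hX hXs hσ2.le hsq, ← mul_assoc,
        ← ENNReal.ofReal_mul (inv_nonneg.mpr hσ2.le), inv_mul_cancel₀ hσ2.ne',
        ENNReal.ofReal_one, one_mul]
    have : IsFiniteMeasure (volume.withDensity
        (fun t => ENNReal.ofReal (σ2⁻¹ * ∫ ω, Set.indicator {ω' | t < X ω'} X ω ∂P))) := by
      refine ⟨?_⟩
      have h := key 1
      simp only [BoundedContinuousFunction.coe_one, Pi.one_apply, ENNReal.coe_one,
        lintegral_one] at h
      rw [← h]
      exact measure_lt_top _ _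
    exact ext_of_forall_lintegral_eq_of_IsFiniteMeasure key
  · intro t
    have hset : MeasurableSet {ω | t < X ω} := measurableSet_lt measurable_const hX
    have hcompl : {ω | X ω ≤ t} = {ω | t < X ω}ᶜ := by
      ext ω
      simp
    have hadd := integral_add_compl hset hint
    rw [hmean] at hadd
    rw [hcompl, integral_indicator hset, integral_indicator hset.compl,
      eq_neg_of_add_eq_zero_left hadd, mul_neg]
end

section
/- Let X be a real random variable with mean zero and finite variance σ² > 0, and let X* have the zero bias distribution of X. Then the topological support of the law of X* is the closed convex hull of the topological support of the law of X; in particular, if X is almost surely bounded then X* is almost surely bounded. -/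
open MeasureTheory

/-- The topological support of a measure on `ℝ`: the set of points all of whose
neighborhoods have positive measure. -/
def measSupport (μ : Measure ℝ) : Set ℝ := {x | ∀ U ∈ nhds x, 0 < μ U}

theorem measSupport_eq_support (μ : Measure ℝ) : measSupport μ = μ.support := by
  ext x
  exact (Measure.mem_support_iff_forall x).symm

section

variable {Ω : Type*} [MeasurableSpace Ω] {P : Measure Ω} {X Xs : Ω → ℝ} {σ2 : ℝ}

theorem ae_mem_measSupport_map (hX : Measurable X) :
    ∀ᵐ ω ∂P, X ω ∈ measSupport (P.map X) := by
  rw [measSupport_eq_support]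
  exact ae_of_ae_map hX.aemeasurable Measure.support_mem_ae

theorem closure_convexHull_measSupport_map_subset (hX : Measurable X) {T : Set ℝ}
    (hT : IsClosed T) (hTc : Convex ℝ T) (h : ∀ᵐ ω ∂P, X ω ∈ T) :
    closure (convexHull ℝ (measSupport (P.map X))) ⊆ T := by
  refine closure_minimal (convexHull_min ?_ hTc) hT
  rw [measSupport_eq_support]
  exact Measure.support_subset_of_isClosed hT
    ((ae_map_iff hX.aemeasurable hT.measurableSet).2 h)

/-- The zero bias identity for the primitive, vanishing at `0`, of a bounded continuous
function. -/
theorem IsZeroBias.integral_mul_primitive [IsFiniteMeasure P] (hzb : IsZeroBias P X Xs σ2)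
    (hX : Measurable X) (hXs : Measurable Xs) (hX2 : Integrable (fun ω => X ω ^ 2) P)
    {g : ℝ → ℝ} (hg : Continuous g) {C : ℝ} (hC : ∀ x, |g x| ≤ C) :
    ∫ ω, X ω * (∫ t in (0 : ℝ)..X ω, g t) ∂P = σ2 * ∫ ω, g (Xs ω) ∂P ∧
      Integrable (fun ω => X ω * ∫ t in (0 : ℝ)..X ω, g t) P := by
  have hder : ∀ x, HasDerivAt (fun x => ∫ t in (0 : ℝ)..x, g t) (g x) x := fun x =>
    intervalIntegral.integral_hasDerivAt_right (hg.intervalIntegrable _ _)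
      hg.aestronglyMeasurable.stronglyMeasurableAtFilter hg.continuousAt
  have hcont : Continuous fun x => ∫ t in (0 : ℝ)..x, g t :=
    continuous_iff_continuousAt.2 fun x => (hder x).continuousAt
  have hbound : ∀ x : ℝ, |∫ t in (0 : ℝ)..x, g t| ≤ C * |x| := fun x => by
    simpa using intervalIntegral.norm_integral_le_of_norm_le_const
      (a := 0) (b := x) (f := g) (C := C) fun t _ => hC t
  have hI : Integrable (fun ω => X ω * ∫ t in (0 : ℝ)..X ω, g t) P := by
    refine (hX2.const_mul C).mono'
      (hX.mul (hcont.measurable.comp hX)).aestronglyMeasurable (.of_forall fun ω => ?_)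
    rw [Real.norm_eq_abs, abs_mul, ← sq_abs]
    nlinarith [hbound (X ω), abs_nonneg (X ω)]
  refine ⟨hzb _ g hder hI ?_, hI⟩
  exact Integrable.of_bound (hg.measurable.comp hXs).aestronglyMeasurable C
    (.of_forall fun ω => hC _)

end

/-- The tent function of height and radius `r` centred at `a`. -/
def tent (a r x : ℝ) : ℝ := max 0 (r - |x - a|)

theorem continuous_tent (a r : ℝ) : Continuous (tent a r) := by
  unfold tent
  fun_prop

theorem tent_nonneg (a r x : ℝ) : 0 ≤ tent a r x := le_max_left _ _

theorem abs_tent_le {r : ℝ} (hr : 0 ≤ r) (a x : ℝ) : |tent a r x| ≤ r := by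
  rw [abs_of_nonneg (tent_nonneg a r x)]
  exact max_le hr (by linarith [abs_nonneg (x - a)])

theorem tent_pos_iff {a r x : ℝ} : 0 < tent a r x ↔ x ∈ Metric.ball a r := by
  simp [tent, Real.dist_eq]

theorem tent_eq_zero {a r x : ℝ} (h : x ∉ Metric.ball a r) : tent a r x = 0 :=
  le_antisymm (not_lt.1 (mt tent_pos_iff.1 h)) (tent_nonneg a r x)

theorem mul_primitive_nonneg {g : ℝ → ℝ} (h0 : ∀ x, 0 ≤ g x) (x : ℝ) :
    0 ≤ x * ∫ t in (0 : ℝ)..x, g t := by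
  rcases le_total 0 x with hx | hx
  · exact mul_nonneg hx (intervalIntegral.integral_nonneg hx fun t _ => h0 t)
  · rw [intervalIntegral.integral_symm]
    nlinarith [intervalIntegral.integral_nonneg (μ := volume) hx fun t _ => h0 t]

theorem le_of_mul_primitive_eq_zero {g : ℝ → ℝ} (hg : Continuous g) (h0 : ∀ x, 0 ≤ g x)
    {b x : ℝ} (hb : 0 ≤ b) (hgb : 0 < g b) (h : x * ∫ t in (0 : ℝ)..x, g t = 0) : x ≤ b := by
  by_contra! hx
  have hpos : 0 < ∫ t in (0 : ℝ)..x, g t :=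
    intervalIntegral.integral_pos (hb.trans_lt hx) hg.continuousOn (fun t _ => h0 t)
      ⟨b, ⟨hb, hx.le⟩, hgb⟩
  exact (mul_pos (hb.trans_lt hx) hpos).ne' h

theorem ge_of_mul_primitive_eq_zero {g : ℝ → ℝ} (hg : Continuous g) (h0 : ∀ x, 0 ≤ g x)
    {b x : ℝ} (hb : b ≤ 0) (hgb : 0 < g b) (h : x * ∫ t in (0 : ℝ)..x, g t = 0) : b ≤ x := by
  by_contra! hx
  have hpos : 0 < ∫ t in x..(0 : ℝ), g t :=
    intervalIntegral.integral_pos (hx.trans_le hb) hg.continuousOn (fun t _ => h0 t)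
      ⟨b, ⟨hx.le, hb⟩, hgb⟩
  rw [intervalIntegral.integral_symm] at h
  nlinarith [mul_pos_of_neg_of_neg (hx.trans_le hb) (neg_neg_of_pos hpos)]

section

variable {Ω : Type*} [MeasurableSpace Ω] {P : Measure Ω} [IsProbabilityMeasure P]
  {X Xs : Ω → ℝ} {σ2 : ℝ}

theorem measSupport_zeroBias_subset (hX : Measurable X) (hXs : Measurable Xs)
    (hσ2 : 0 < σ2) (hX2 : Integrable (fun ω => X ω ^ 2) P)
    (hmean : ∫ ω, X ω ∂P = 0) (hzb : IsZeroBias P X Xs σ2) :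
    measSupport (P.map Xs) ⊆ closure (convexHull ℝ (measSupport (P.map X))) := by
  set K := closure (convexHull ℝ (measSupport (P.map X)))
  intro a ha
  by_contra haK
  obtain ⟨r, hr, hball⟩ := Metric.isOpen_iff.1 isClosed_closure.isOpen_compl a haK
  have hXK : ∀ᵐ ω ∂P, X ω ∈ K := (ae_mem_measSupport_map hX).mono fun ω h =>
    subset_closure (subset_convexHull ℝ _ h)
  obtain ⟨ω₀, hk⟩ := hXK.exists
  have hcont := continuous_tent a r
  have hprim : ∀ z ∈ K, ∫ t in (0 : ℝ)..z, tent a r t = ∫ t in (0 : ℝ)..X ω₀, tent a r t := by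
    intro z hz
    rw [← intervalIntegral.integral_add_adjacent_intervals (b := X ω₀)
      (hcont.intervalIntegrable _ _) (hcont.intervalIntegrable _ _), add_eq_left]
    rw [intervalIntegral.integral_congr (g := fun _ => 0), intervalIntegral.integral_zero]
    intro t ht
    have htK : t ∈ K := (convex_convexHull ℝ _).closure.ordConnected.uIcc_subset hk hz ht
    exact tent_eq_zero fun h => hball h htK
  obtain ⟨hid, -⟩ := hzb.integral_mul_primitive hX hXs hX2 hcont (abs_tent_le hr.le a)
  have hzero : ∫ ω, X ω * (∫ t in (0 : ℝ)..X ω, tent a r t) ∂P = 0 := by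
    rw [integral_congr_ae (hXK.mono fun ω h => congrArg (X ω * ·) (hprim _ h)),
      integral_mul_const, hmean, zero_mul]
  have hXs0 : ∫ ω, tent a r (Xs ω) ∂P = 0 := by
    simpa [hσ2.ne'] using hid.symm.trans hzero
  rw [integral_eq_zero_iff_of_nonneg (fun ω => tent_nonneg a r _)
    (Integrable.of_bound (hcont.measurable.comp hXs).aestronglyMeasurable r
      (.of_forall fun ω => abs_tent_le hr.le a _))] at hXs0
  refine (ha _ (Metric.ball_mem_nhds a hr)).ne' ?_
  rw [Measure.map_apply hXs Metric.isOpen_ball.measurableSet]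
  exact measure_mono_null (fun ω hω => (tent_pos_iff.2 hω).ne') (ae_iff.1 hXs0)

theorem subset_measSupport_zeroBias (hX : Measurable X) (hXs : Measurable Xs)
    (hvar : ∫ ω, X ω ^ 2 ∂P ≠ 0) (hzb : IsZeroBias P X Xs σ2) :
    closure (convexHull ℝ (measSupport (P.map X))) ⊆ measSupport (P.map Xs) := by
  intro a haK
  by_contra ha
  have hX2 : Integrable (fun ω => X ω ^ 2) P := .of_integral_ne_zero hvar
  rw [measSupport_eq_support, Measure.notMem_support_iff_exists] at ha
  obtain ⟨U, hU, hU0⟩ := ha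
  obtain ⟨r, hr, hball⟩ := Metric.mem_nhds_iff.1 hU
  have hnull := measure_mono_null hball hU0
  rw [Measure.map_apply hXs Metric.isOpen_ball.measurableSet] at hnull
  have hcont := continuous_tent a r
  have h0 := tent_nonneg a r
  obtain ⟨hid, hI⟩ := hzb.integral_mul_primitive hX hXs hX2 hcont (abs_tent_le hr.le a)
  have hXs0 : ∫ ω, tent a r (Xs ω) ∂P = 0 :=
    integral_eq_zero_of_ae ((measure_eq_zero_iff_ae_notMem.1 hnull).mono
      fun ω h => tent_eq_zero h)
  rw [hXs0, mul_zero, integral_eq_zero_iff_of_nonneg (fun ω => mul_primitive_nonneg h0 _) hI]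
    at hid
  rcases lt_trichotomy a 0 with hneg | rfl | hpos
  · have hb : 0 < tent a r (min 0 (a + r / 2)) := by
      rw [tent_pos_iff, Metric.mem_ball, Real.dist_eq, abs_lt]
      constructor <;> rcases min_cases 0 (a + r / 2) with h | h <;> linarith
    have hle := closure_convexHull_measSupport_map_subset hX isClosed_Ici (convex_Ici _)
      (hid.mono fun ω h => ge_of_mul_primitive_eq_zero hcont h0 (min_le_left _ _) hb h) haK
    exact (lt_min hneg (by linarith)).not_ge hle
  · have hb : 0 < tent 0 r 0 := tent_pos_iff.2 (Metric.mem_ball_self hr)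
    refine hvar (integral_eq_zero_of_ae (hid.mono fun ω h => ?_))
    have hω : X ω = 0 := le_antisymm (le_of_mul_primitive_eq_zero hcont h0 le_rfl hb h)
      (ge_of_mul_primitive_eq_zero hcont h0 le_rfl hb h)
    simp [hω]
  · have hb : 0 < tent a r (max 0 (a - r / 2)) := by
      rw [tent_pos_iff, Metric.mem_ball, Real.dist_eq, abs_lt]
      constructor <;> rcases max_cases 0 (a - r / 2) with h | h <;> linarith
    have hle := closure_convexHull_measSupport_map_subset hX isClosed_Iic (convex_Iic _)
      (hid.mono fun ω h => le_of_mul_primitive_eq_zero hcont h0 (le_max_left _ _) hb h) haK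
    exact (max_lt hpos (by linarith)).not_ge hle

end

/-- The support of the zero bias distribution is the closed convex hull of the
support of the original distribution; in particular, `X*` is (almost surely)
bounded whenever `X` is (almost surely) bounded. -/
theorem zeroBias_support {Ω : Type*} [MeasurableSpace Ω] (P : Measure Ω)
    [IsProbabilityMeasure P] (X Xs : Ω → ℝ) (hX : Measurable X) (hXs : Measurable Xs)
    (σ2 : ℝ) (hσ2 : 0 < σ2) (hint : Integrable X P)
    (hmean : ∫ ω, X ω ∂P = 0) (hvar : ∫ ω, (X ω) ^ 2 ∂P = σ2)
    (hzb : IsZeroBias P X Xs σ2) :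
    measSupport (Measure.map Xs P) = closure (convexHull ℝ (measSupport (Measure.map X P))) ∧
    ∀ C : ℝ, (∀ᵐ ω ∂P, |X ω| ≤ C) → ∃ C' : ℝ, ∀ᵐ ω ∂P, |Xs ω| ≤ C' := by
  have hvar0 : ∫ ω, X ω ^ 2 ∂P ≠ 0 := hvar ▸ hσ2.ne'
  have hsub := measSupport_zeroBias_subset hX hXs hσ2 (.of_integral_ne_zero hvar0) hmean hzb
  refine ⟨hsub.antisymm (subset_measSupport_zeroBias hX hXs hvar0 hzb), fun C hC => ⟨C, ?_⟩⟩
  filter_upwards [ae_mem_measSupport_map hXs] with ω hω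
  exact abs_le.2 (closure_convexHull_measSupport_map_subset hX isClosed_Icc (convex_Icc (-C) C)
    (hC.mono fun ω h => abs_le.1 h) (hsub hω))
end

section
/- Let X be a real random variable with mean zero and finite variance σ² > 0, let X* have the zero bias distribution of X, and let k, c > 0. If X* ≤_{σ,k} X + c (that is, σ² E[f(X*)] ≤ k² E[f(X + c)] for every increasing positive function f for which both expectations exist), then for all x ≥ 0, P(X ≥ x) ≤ exp(−x²/(2(k² + c x))). -/
open MeasureTheory

/-- `Y ≤_{σ,k} X` (weighted stochastic domination, with `σ2 = σ²`, `k2 = k²`):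
`σ² E[f(Y)] ≤ k² E[f(X)]` for every increasing positive function `f` for which
both expectations exist. -/
def WeightedDom {Ω : Type*} [MeasurableSpace Ω] (P : Measure Ω)
    (Y X : Ω → ℝ) (σ2 k2 : ℝ) : Prop :=
  ∀ f : ℝ → ℝ, Monotone f → (∀ x, 0 < f x) →
    Integrable (fun ω => f (Y ω)) P → Integrable (fun ω => f (X ω)) P →
    σ2 * ∫ ω, f (Y ω) ∂P ≤ k2 * ∫ ω, f (X ω) ∂P

open ProbabilityTheory Real

/-- The exponential `exp (θ x)`, continued by its tangent line to the right of `n`. -/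
noncomputable def expTangent (θ n x : ℝ) : ℝ :=
  exp (θ * min x n) * (1 + θ * (x - min x n))

theorem hasDerivAt_expTangent (θ n x : ℝ) :
    HasDerivAt (expTangent θ n) (θ * exp (θ * min x n)) x := by
  have hleft : ∀ y ≤ n, expTangent θ n y = exp (θ * y) := fun y hy => by
    simp [expTangent, min_eq_left hy]
  have hright : ∀ y, n ≤ y → expTangent θ n y = exp (θ * n) * (1 + θ * (y - n)) :=
    fun y hy => by simp [expTangent, min_eq_right hy]
  have hexp : HasDerivAt (fun y => exp (θ * y)) (θ * exp (θ * x)) x := by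
    simpa [mul_comm] using ((hasDerivAt_id x).const_mul θ).exp
  have hlin : HasDerivAt (fun y => exp (θ * n) * (1 + θ * (y - n))) (θ * exp (θ * n)) x := by
    simpa [mul_comm] using
      ((((hasDerivAt_id x).sub_const n).const_mul θ).const_add 1).const_mul (exp (θ * n))
  rcases lt_trichotomy x n with h | h | h
  · rw [min_eq_left h.le]
    refine hexp.congr_of_eventuallyEq ?_
    filter_upwards [Iio_mem_nhds h] with y hy using hleft y (le_of_lt hy)
  · subst h
    rw [min_self, ← hasDerivWithinAt_univ, ← Set.Iic_union_Ici (a := x)]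
    exact (hexp.hasDerivWithinAt.congr (fun y hy => hleft y hy) (hleft x le_rfl)).union
      (hlin.hasDerivWithinAt.congr (fun y hy => hright y hy) (hright x le_rfl))
  · rw [min_eq_right h.le]
    refine hlin.congr_of_eventuallyEq ?_
    filter_upwards [Ioi_mem_nhds h] with y hy using hright y (le_of_lt hy)

theorem min_mul_exp_le_mul_expTangent {θ n : ℝ} (hθ : 0 ≤ θ) (hn : 0 ≤ n) (x : ℝ) :
    min x n * exp (θ * min x n) ≤ x * expTangent θ n x := by
  rcases le_total x n with h | h
  · simp [expTangent, min_eq_left h]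
  · simp only [expTangent, min_eq_right h]
    have h1 : exp (θ * n) ≤ exp (θ * n) * (1 + θ * (x - n)) :=
      le_mul_of_one_le_right (exp_pos _).le
        (le_add_of_nonneg_right (mul_nonneg hθ (sub_nonneg.2 h)))
    exact mul_le_mul h h1 (exp_pos _).le (hn.trans h)

theorem abs_mul_expTangent_le {θ n : ℝ} (hθ : 0 ≤ θ) (hn : 0 ≤ n) (x : ℝ) :
    |x * expTangent θ n x| ≤ exp (θ * n) * (|x| + θ * x ^ 2) := by
  have h0 : 0 ≤ x - min x n := sub_nonneg.2 (min_le_left _ _)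
  have h1 : x - min x n ≤ |x| := by
    rcases le_total x n with h | h
    · simp [min_eq_left h]
    · rw [min_eq_right h]
      linarith [le_abs_self x]
  have h2 : exp (θ * min x n) ≤ exp (θ * n) :=
    exp_le_exp.2 (mul_le_mul_of_nonneg_left (min_le_right _ _) hθ)
  have h3 : 0 ≤ expTangent θ n x := by unfold expTangent; positivity
  rw [abs_mul, abs_of_nonneg h3, ← sq_abs x]
  calc |x| * expTangent θ n x ≤ |x| * (exp (θ * n) * (1 + θ * |x|)) := by
        unfold expTangent; gcongr
    _ = exp (θ * n) * (|x| + θ * |x| ^ 2) := by ring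

theorem exp_le_one_sub_half_div_sq {u : ℝ} (h0 : 0 ≤ u) (h1 : u < 1) :
    exp u ≤ (1 - u / 2) / (1 - u) ^ 2 := by
  have hu : 0 < 1 - u := sub_pos.2 h1
  refine (exp_bound_div_one_sub_of_interval h0 h1).trans ?_
  rw [div_le_div_iff₀ hu (by positivity)]
  nlinarith

theorem hasDerivAt_sq_div_one_sub {c θ : ℝ} (h : c * θ < 1) :
    HasDerivAt (fun t => t ^ 2 / (2 * (1 - c * t)))
      (θ * ((1 - c * θ / 2) / (1 - c * θ) ^ 2)) θ := by
  have hne : 1 - c * θ ≠ 0 := (sub_pos.2 h).ne'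
  have hd : HasDerivAt (fun t => 2 * (1 - c * t)) (2 * -(c * 1)) θ :=
    (((hasDerivAt_id θ).const_mul c).const_sub 1).const_mul 2
  refine ((hasDerivAt_pow 2 θ).div hd (by positivity)).congr_deriv ?_
  field_simp
  ring

section Truncation

variable {Ω : Type*} [MeasurableSpace Ω] {P : Measure Ω} [IsProbabilityMeasure P] {Y : Ω → ℝ}

theorem integrable_exp_mul_of_le {n θ : ℝ} (hY : Measurable Y) (hle : ∀ ω, Y ω ≤ n)
    (hθ : 0 ≤ θ) : Integrable (fun ω => exp (θ * Y ω)) P := by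
  refine Integrable.of_bound (by fun_prop) (exp (θ * n)) (ae_of_all _ fun ω => ?_)
  rw [norm_of_nonneg (exp_pos _).le]
  exact exp_le_exp.2 (mul_le_mul_of_nonneg_left (hle ω) hθ)

theorem mem_interior_integrableExpSet_of_le {n θ : ℝ} (hY : Measurable Y)
    (hle : ∀ ω, Y ω ≤ n) (hθ : 0 < θ) : θ ∈ interior (integrableExpSet Y P) :=
  mem_interior_iff_mem_nhds.2 <| Filter.mem_of_superset (Ioi_mem_nhds hθ) fun _ ht =>
    integrable_exp_mul_of_le hY hle (le_of_lt ht)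

theorem continuousOn_mgf_of_le {n T : ℝ} (hY : Measurable Y) (hle : ∀ ω, Y ω ≤ n)
    (hn : 0 ≤ n) : ContinuousOn (mgf Y P) (Set.Icc 0 T) := by
  refine continuousOn_of_dominated (bound := fun _ => exp (T * n))
    (fun t _ => by fun_prop) (fun t ht => ae_of_all _ fun ω => ?_) (integrable_const _)
    (ae_of_all _ fun ω => by fun_prop)
  rw [norm_of_nonneg (exp_pos _).le]
  exact exp_le_exp.2 ((mul_le_mul_of_nonneg_left (hle ω) ht.1).trans
    (mul_le_mul_of_nonneg_right ht.2 hn))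

/-- A differential inequality for the moment generating function of a variable bounded above
yields a sub-Gamma bound. -/
theorem mgf_le_of_integral_mul_exp_le {n K c T : ℝ} (hY : Measurable Y) (hle : ∀ ω, Y ω ≤ n)
    (hn : 0 ≤ n) (hK : 0 ≤ K) (hc : 0 ≤ c) (hT : 0 ≤ T) (hcT : c * T < 1)
    (h : ∀ θ, 0 < θ →
      ∫ ω, Y ω * exp (θ * Y ω) ∂P ≤ K * (θ * exp (c * θ)) * mgf Y P θ) :
    mgf Y P T ≤ exp (K * (T ^ 2 / (2 * (1 - c * T)))) := by
  have hpos : ∀ θ, 0 ≤ θ → 0 < mgf Y P θ := fun θ hθ =>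
    mgf_pos (integrable_exp_mul_of_le hY hle hθ)
  have hlt : ∀ θ, θ ≤ T → c * θ < 1 := fun θ hθ =>
    (mul_le_mul_of_nonneg_left hθ hc).trans_lt hcT
  have hanti : AntitoneOn (fun θ => log (mgf Y P θ) - K * (θ ^ 2 / (2 * (1 - c * θ))))
      (Set.Icc 0 T) := by
    refine antitoneOn_of_hasDerivWithinAt_nonpos (convex_Icc 0 T)
      (f' := fun θ => (∫ ω, Y ω * exp (θ * Y ω) ∂P) / mgf Y P θ -
        K * (θ * ((1 - c * θ / 2) / (1 - c * θ) ^ 2))) ?_ ?_ ?_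
    · refine ((continuousOn_mgf_of_le hY hle hn).log fun θ hθ => (hpos θ hθ.1).ne').sub ?_
      exact fun θ hθ =>
        ((hasDerivAt_sq_div_one_sub (hlt θ hθ.2)).const_mul K).continuousAt.continuousWithinAt
    · intro θ hθ
      rw [interior_Icc] at hθ
      exact (((hasDerivAt_mgf (mem_interior_integrableExpSet_of_le hY hle hθ.1)).log
        (hpos θ hθ.1.le).ne').sub
        ((hasDerivAt_sq_div_one_sub (hlt θ hθ.2.le)).const_mul K)).hasDerivWithinAt
    · intro θ hθ
      rw [interior_Icc] at hθ
      have hθ0 : 0 ≤ θ := hθ.1.le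
      rw [sub_nonpos, div_le_iff₀ (hpos θ hθ0)]
      refine (h θ hθ.1).trans (mul_le_mul_of_nonneg_right ?_ (hpos θ hθ0).le)
      have := exp_le_one_sub_half_div_sq (mul_nonneg hc hθ0) (hlt θ hθ.2.le)
      gcongr
  have := hanti (Set.left_mem_Icc.2 hT) (Set.right_mem_Icc.2 hT) hT
  simp only [mgf_zero, log_one] at this
  rw [← log_le_iff_le_exp (hpos T hT)]
  norm_num at this
  exact this

end Truncation

theorem integral_min_mul_exp_le {Ω : Type*} [MeasurableSpace Ω] {P : Measure Ω}
    [IsProbabilityMeasure P] {X Xs : Ω → ℝ} (hX : Measurable X) (hXs : Measurable Xs)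
    {σ2 k2 c n θ : ℝ} (hint : Integrable X P) (hsq : Integrable (fun ω => X ω ^ 2) P)
    (hzb : IsZeroBias P X Xs σ2) (hdom : WeightedDom P Xs (fun ω => X ω + c) σ2 k2)
    (hk : 0 ≤ k2) (hc : 0 ≤ c) (hn : 0 ≤ n) (hθ : 0 < θ) :
    ∫ ω, min (X ω) n * exp (θ * min (X ω) n) ∂P ≤
      k2 * (θ * exp (c * θ)) * mgf (fun ω => min (X ω) n) P θ := by
  have hmin : Measurable fun ω => min (X ω) n := hX.min measurable_const
  have hle : ∀ ω, min (X ω) n ≤ n := fun ω => min_le_right _ _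
  have hbdd : ∀ {Z : Ω → ℝ}, Measurable Z →
      Integrable (fun ω => θ * exp (θ * min (Z ω) n)) P := fun hZ =>
    (integrable_exp_mul_of_le (hZ.min measurable_const)
      (fun ω => min_le_right _ _) hθ.le).const_mul θ
  have hcont : Continuous (expTangent θ n) := by unfold expTangent; fun_prop
  have hf : Integrable (fun ω => X ω * expTangent θ n (X ω)) P := by
    refine Integrable.mono' ((hint.abs.add (hsq.const_mul θ)).const_mul (exp (θ * n)))
      (hX.mul (hcont.measurable.comp hX)).aestronglyMeasurable
      (ae_of_all _ fun ω => abs_mul_expTangent_le hθ.le hn (X ω))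
  have hYint : Integrable (fun ω => min (X ω) n * exp (θ * min (X ω) n)) P := by
    simpa using integrable_pow_mul_exp_of_mem_interior_integrableExpSet
      (mem_interior_integrableExpSet_of_le (P := P) hmin hle hθ) 1
  have hmono : Monotone fun x => θ * exp (θ * min x n) := fun x y hxy => by
    dsimp only
    gcongr
  calc ∫ ω, min (X ω) n * exp (θ * min (X ω) n) ∂P
      ≤ ∫ ω, X ω * expTangent θ n (X ω) ∂P :=
        integral_mono hYint hf fun ω => min_mul_exp_le_mul_expTangent hθ.le hn (X ω)
    _ = σ2 * ∫ ω, θ * exp (θ * min (Xs ω) n) ∂P :=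
        hzb _ _ (hasDerivAt_expTangent θ n) hf (hbdd hXs)
    _ ≤ k2 * ∫ ω, θ * exp (θ * min (X ω + c) n) ∂P :=
        hdom _ hmono (fun x => by positivity) (hbdd hXs) (hbdd (hX.add_const c))
    _ ≤ k2 * ∫ ω, (θ * exp (c * θ)) * exp (θ * min (X ω) n) ∂P := by
        refine mul_le_mul_of_nonneg_left (integral_mono (hbdd (hX.add_const c))
          ((integrable_exp_mul_of_le hmin hle hθ.le).const_mul _) fun ω => ?_) hk
        have hshift : min (X ω + c) n ≤ min (X ω) n + c := by
          rw [← min_add_add_right]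
          exact min_le_min le_rfl (le_add_of_nonneg_right hc)
        dsimp only
        rw [mul_assoc, ← exp_add]
        gcongr
        nlinarith
    _ = k2 * (θ * exp (c * θ)) * mgf (fun ω => min (X ω) n) P θ := by
        rw [integral_const_mul, ← mul_assoc]
        rfl

/-- If `X* ≤_{σ,k} X + c` for positive constants `k, c`, then `X` has a
sub-Gamma right tail: `P(X ≥ x) ≤ exp(-x²/(2(k² + c x)))` for all `x ≥ 0`. -/
theorem subGamma_of_zeroBias_shift_dom {Ω : Type*} [MeasurableSpace Ω] (P : Measure Ω)
    [IsProbabilityMeasure P] (X Xs : Ω → ℝ) (hX : Measurable X) (hXs : Measurable Xs)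
    (σ2 : ℝ) (hσ2 : 0 < σ2) (hint : Integrable X P)
    (hmean : ∫ ω, X ω ∂P = 0) (hvar : ∫ ω, (X ω) ^ 2 ∂P = σ2)
    (hzb : IsZeroBias P X Xs σ2)
    (k c : ℝ) (hk : 0 < k) (hc : 0 < c)
    (hdom : WeightedDom P Xs (fun ω => X ω + c) σ2 (k ^ 2)) :
    ∀ x : ℝ, 0 ≤ x →
      (P {ω | x ≤ X ω}).toReal ≤ Real.exp (-(x ^ 2) / (2 * (k ^ 2 + c * x))) := by
  intro x hx
  have hsq : Integrable (fun ω => X ω ^ 2) P :=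
    Integrable.of_integral_ne_zero (hvar.trans_ne hσ2.ne')
  have hden : 0 < k ^ 2 + c * x := by positivity
  have hT : 0 ≤ x / (k ^ 2 + c * x) := by positivity
  have hsub : 1 - c * (x / (k ^ 2 + c * x)) = k ^ 2 / (k ^ 2 + c * x) := by
    field_simp
    ring
  have hcT : c * (x / (k ^ 2 + c * x)) < 1 := by
    have : 0 < k ^ 2 / (k ^ 2 + c * x) := by positivity
    linarith
  have hmin : Measurable fun ω => min (X ω) x := hX.min measurable_const
  have hle : ∀ ω, min (X ω) x ≤ x := fun ω => min_le_right _ _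
  have hmgf := mgf_le_of_integral_mul_exp_le hmin hle hx (sq_nonneg k) hc.le hT hcT
    fun θ hθ => integral_min_mul_exp_le hX hXs hint hsq hzb hdom (sq_nonneg k) hc.le hx hθ
  have hset : {ω | x ≤ X ω} = {ω | x ≤ min (X ω) x} := by
    ext ω
    simp
  rw [hset]
  refine (measure_ge_le_exp_mul_mgf x hT (integrable_exp_mul_of_le hmin hle hT)).trans ?_
  refine (mul_le_mul_of_nonneg_left hmgf (exp_pos _).le).trans_eq ?_
  rw [← exp_add, hsub]
  congr 1
  field_simp
  ring
end

section
/- Let A = (a_{ij}) be an n × n real matrix, let π be a uniformly random permutation of {1, …, n}, and set Y = Σ_{i=1}^n a_{iπ(i)} and c_i = max_j a_{ij} − min_j a_{ij}. Then for all t ≥ 0, P(Y − E[Y] ≥ t) ≤ exp(−t² / Σ_{i=1}^n c_i²). -/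
open MeasureTheory

/-- The inequality `tanh (t / 2) ≤ t / 2` for `0 ≤ t`, cleared of denominators. -/
lemma two_mul_exp_sub_one_le {t : ℝ} (ht : 0 ≤ t) :
    2 * (Real.exp t - 1) ≤ t * (Real.exp t + 1) := by
  have hderiv : ∀ x : ℝ, HasDerivAt (fun x => x * (Real.exp x + 1) - 2 * (Real.exp x - 1))
      (1 * (Real.exp x + 1) + x * Real.exp x - 2 * Real.exp x) x := fun x =>
    ((hasDerivAt_id x).mul ((Real.hasDerivAt_exp x).add_const 1)).sub
      (((Real.hasDerivAt_exp x).sub_const 1).const_mul 2)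
  have hmono : Monotone fun x : ℝ => x * (Real.exp x + 1) - 2 * (Real.exp x - 1) := by
    refine monotone_of_deriv_nonneg (fun x => (hderiv x).differentiableAt) fun x => ?_
    rw [(hderiv x).deriv]
    have h1 := mul_le_mul_of_nonneg_right (Real.add_one_le_exp (-x)) (Real.exp_pos x).le
    rw [← Real.exp_add, neg_add_cancel, Real.exp_zero] at h1
    linarith
  have h := hmono ht
  simp only [Real.exp_zero] at h
  linarith

/-- If the weights `p` vary at most by a factor `exp (2 * t)` and `b` has range at most `1`, then
the `p`-average of `b` exceeds its plain average by at most `t / 2`. -/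
lemma sum_mul_sub_mean_le_of_le_exp_mul {ι : Type*} [Fintype ι] [Nonempty ι]
    {p b : ι → ℝ} {t : ℝ} (hp : ∀ j, 0 < p j) (ht : 0 < t)
    (hpt : ∀ j k, p j ≤ Real.exp (2 * t) * p k) (hb : ∀ j k, b j - b k ≤ 1) :
    ∑ j, p j * (b j - (∑ k, b k) / Fintype.card ι) ≤ t / 2 * ∑ j, p j := by
  obtain ⟨u, hu⟩ := Finite.exists_min p
  obtain ⟨v, hv⟩ := Finite.exists_min b
  set N : ℝ := (Fintype.card ι : ℝ) with hN
  have hNpos : 0 < N := by simp [hN, Fintype.card_pos]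
  set K := Real.exp t with hK
  have hK1 : 1 < K := Real.one_lt_exp_iff.mpr ht
  have hKK : Real.exp (2 * t) = K ^ 2 := by rw [hK, ← Real.exp_nat_mul]; norm_num
  set m := p u with hm
  have hm0 : 0 < m := hp u
  set q := (∑ j, p j) / N with hq
  have hPq : ∑ j, p j = N * q := by rw [hq]; field_simp
  have hupper : ∀ j, p j ≤ K ^ 2 * m := fun j => hKK ▸ hpt j u
  have hmq : m ≤ q := by
    rw [hq, le_div_iff₀ hNpos]
    calc m * N = ∑ _j : ι, m := by simp [hN, mul_comm]
      _ ≤ _ := Finset.sum_le_sum fun j _ => hu j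
  have hqM : q ≤ K ^ 2 * m := by
    rw [hq, div_le_iff₀ hNpos]
    calc ∑ j, p j ≤ ∑ _j : ι, K ^ 2 * m := Finset.sum_le_sum fun j _ => hupper j
      _ = _ := by simp [hN, mul_comm]
  have hcenter : ∑ j, p j * (b j - (∑ k, b k) / N) = ∑ j, (p j - q) * (b j - b v) := by
    have h1 : ∑ j, p j * (b j - (∑ k, b k) / N)
        = ∑ j, p j * b j - (N * q) * ((∑ k, b k) / N) := by
      simp only [mul_sub, Finset.sum_sub_distrib, ← Finset.sum_mul, hPq]
    have h2 : ∑ j, (p j - q) * (b j - b v)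
        = ∑ j, p j * b j - N * q * b v - (q * ∑ k, b k - N * (q * b v)) := by
      simp only [mul_sub, sub_mul, Finset.sum_sub_distrib, ← Finset.sum_mul, ← Finset.mul_sum, hPq]
      simp [hN]
      ring
    rw [h1, h2]
    field_simp
    ring
  rw [hcenter]
  have hterm : ∀ j, (K ^ 2 * m - m) * ((p j - q) * (b j - b v)) ≤ (p j - m) * (K ^ 2 * m - q) := by
    intro j
    have hx0 : 0 ≤ b j - b v := sub_nonneg.mpr (hv j)
    have hx1 := hb j v
    have hpm : 0 ≤ p j - m := sub_nonneg.mpr (hu j)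
    have hpM := hupper j
    have hMm : 0 ≤ K ^ 2 * m - m := by linarith
    rcases le_total (p j) q with h | h
    · have : (p j - q) * (b j - b v) ≤ 0 := mul_nonpos_of_nonpos_of_nonneg (by linarith) hx0
      have h' := mul_nonpos_of_nonneg_of_nonpos hMm this
      have := mul_nonneg hpm (sub_nonneg.mpr hqM)
      linarith
    · have h1 : (p j - q) * (b j - b v) ≤ p j - q := by nlinarith
      have h2 := mul_le_mul_of_nonneg_left h1 hMm
      nlinarith [mul_nonneg (sub_nonneg.mpr hpM) (sub_nonneg.mpr hmq)]
  have hsum : (K ^ 2 * m - m) * ∑ j, (p j - q) * (b j - b v)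
      ≤ N * ((q - m) * (K ^ 2 * m - q)) := by
    calc _ = ∑ j, (K ^ 2 * m - m) * ((p j - q) * (b j - b v)) := Finset.mul_sum ..
      _ ≤ ∑ j, (p j - m) * (K ^ 2 * m - q) := Finset.sum_le_sum fun j _ => hterm j
      _ = _ := by
        rw [← Finset.sum_mul, Finset.sum_sub_distrib, hPq]
        simp [hN]
        ring
  have hamgm : (q - m) * (K ^ 2 * m - q) ≤ q * m * (K - 1) ^ 2 := by
    nlinarith [sq_nonneg (q - K * m)]
  have htanh : 2 * (K - 1) ≤ t * (K + 1) := two_mul_exp_sub_one_le ht.le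
  have hq0 : 0 < q := hm0.trans_le hmq
  have hfinal : N * (q * m * (K - 1) ^ 2) ≤ (K ^ 2 * m - m) * (t / 2 * (N * q)) := by
    have h0 : 0 ≤ N * q * m * (K - 1) :=
      mul_nonneg (by positivity) (by linarith)
    nlinarith [mul_le_mul_of_nonneg_left htanh h0]
  rw [hPq]
  have hMm : 0 < K ^ 2 * m - m := by nlinarith
  exact le_of_mul_le_mul_left
    ((hsum.trans (mul_le_mul_of_nonneg_left hamgm hNpos.le)).trans hfinal) hMm

/-- Exchanging two values of a permutation changes a sum `∑ i, α i (π i)` whose rows have range at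
most `t` by at most `2 * t`. -/
lemma sum_perm_le_sum_swap_mul_add {ι : Type*} [Fintype ι] [DecidableEq ι]
    {α : ι → ι → ℝ} {t : ℝ} (hα : ∀ i j k, α i j - α i k ≤ t) (π : Equiv.Perm ι) (j k : ι) :
    ∑ i, α i (π i) ≤ ∑ i, α i ((Equiv.swap j k * π) i) + 2 * t := by
  have ht : 0 ≤ t := by simpa using hα j j j
  have hdiff : ∀ i, α i (π i) - α i ((Equiv.swap j k * π) i)
      ≤ (if π i = j then t else 0) + if π i = k then t else 0 := by
    intro i
    rw [Equiv.Perm.mul_apply]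
    by_cases hj : π i = j
    · have := hα i j k
      rw [hj, Equiv.swap_apply_left, if_pos rfl]
      split_ifs <;> linarith
    · by_cases hk : π i = k
      · have := hα i k j
        rw [hk, Equiv.swap_apply_right, if_pos rfl]
        split_ifs <;> linarith
      · simp [Equiv.swap_apply_of_ne_of_ne hj hk, hj, hk]
  have hsum := Finset.sum_le_sum fun i (_ : i ∈ Finset.univ) => hdiff i
  rw [Finset.sum_sub_distrib, Finset.sum_add_distrib,
    Equiv.sum_comp π (fun x => if x = j then t else 0),
    Equiv.sum_comp π (fun x => if x = k then t else 0)] at hsum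
  simp only [Finset.sum_ite_eq', Finset.mem_univ, if_true] at hsum
  linarith

/-- Under the Gibbs weights `exp (∑ i, α i (π i))` with rows of `α` of range at most `t`, the mean
of `b (π r)` exceeds its uniform mean by at most `t / 2` when `b` has range at most `1`. -/
lemma sum_exp_mul_sub_mean_le {ι : Type*} [Fintype ι] [DecidableEq ι] [Nonempty ι]
    {α : ι → ι → ℝ} {b : ι → ℝ} {t : ℝ} (hα : ∀ i j k, α i j - α i k ≤ t)
    (hb : ∀ j k, b j - b k ≤ 1) (r : ι) :
    ∑ π : Equiv.Perm ι, Real.exp (∑ i, α i (π i)) * (b (π r) - (∑ k, b k) / Fintype.card ι)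
      ≤ t / 2 * ∑ π : Equiv.Perm ι, Real.exp (∑ i, α i (π i)) := by
  set w : Equiv.Perm ι → ℝ := fun π => Real.exp (∑ i, α i (π i)) with hw
  set p : ι → ℝ := fun j => ∑ π : Equiv.Perm ι, if π r = j then w π else 0 with hp
  have ht : 0 ≤ t := by simpa using hα r r r
  have hfiber : ∀ g : ι → ℝ, ∑ π : Equiv.Perm ι, w π * g (π r) = ∑ j, p j * g j := by
    intro g
    simp only [hp, Finset.sum_mul]
    rw [Finset.sum_comm]
    simp
  have hpos : ∀ j, 0 < p j := by
    intro j
    refine Finset.sum_pos' (fun π _ => ?_) ⟨Equiv.swap r j, Finset.mem_univ _, ?_⟩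
    · split_ifs
      exacts [(Real.exp_pos _).le, le_rfl]
    · simp [hw, Real.exp_pos]
  have hratio : ∀ j k, p j ≤ Real.exp (2 * t) * p k := by
    intro j k
    have hreindex : p k = ∑ π : Equiv.Perm ι,
        if (Equiv.swap j k * π) r = k then w (Equiv.swap j k * π) else 0 :=
      (Equiv.sum_comp (Equiv.mulLeft (Equiv.swap j k))
        fun π : Equiv.Perm ι => if π r = k then w π else 0).symm
    rw [hreindex, Finset.mul_sum]
    refine Finset.sum_le_sum fun π _ => ?_
    have hiff : (Equiv.swap j k * π) r = k ↔ π r = j := by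
      rw [Equiv.Perm.mul_apply, Equiv.swap_apply_eq_iff, Equiv.swap_apply_right]
    simp only [hiff]
    split_ifs
    · rw [hw, ← Real.exp_add, Real.exp_le_exp, add_comm]
      exact sum_perm_le_sum_swap_mul_add hα π j k
    · simp
  have hle : ∀ x, t < x → ∑ j, p j * (b j - (∑ k, b k) / Fintype.card ι) ≤ x / 2 * ∑ j, p j := by
    intro x hx
    refine sum_mul_sub_mean_le_of_le_exp_mul hpos (ht.trans_lt hx) (fun j k => ?_) hb
    refine (hratio j k).trans (mul_le_mul_of_nonneg_right ?_ (hpos k).le)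
    exact Real.exp_le_exp.mpr (by linarith)
  have htotal : ∑ π, w π = ∑ j, p j := by simpa using hfiber fun _ => 1
  rw [hfiber fun j => b j - (∑ k, b k) / Fintype.card ι, htotal]
  refine ge_of_tendsto (x := nhdsWithin t (Set.Ioi t)) (f := fun x => x / 2 * ∑ j, p j) ?_
    (Filter.eventually_of_mem self_mem_nhdsWithin hle)
  exact ((by fun_prop : Continuous fun x : ℝ => x / 2 * ∑ j, p j).tendsto t).mono_left
    nhdsWithin_le_nhds

lemma hasDerivWithinAt_min_const (s x : ℝ) :
    HasDerivWithinAt (fun t => min t s) (if x < s then 1 else 0) (Set.Ici x) x := by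
  split_ifs with h
  · refine ((hasDerivAt_id x).congr_of_eventuallyEq ?_).hasDerivWithinAt
    filter_upwards [gt_mem_nhds h] with y hy using min_eq_left hy.le
  · have h := not_lt.mp h
    exact (hasDerivWithinAt_const x _ s).congr (fun y hy => min_eq_right (h.trans hy))
      (min_eq_right h)

/-- Sub-Gaussian bound for the exponential moment of the combinatorial sum `∑ i, s i * b i (π i)`
with rows `b i` of range at most `1`. -/
lemma sum_exp_perm_le {ι : Type*} [Fintype ι] [DecidableEq ι] [Nonempty ι]
    {b : ι → ι → ℝ} {s : ι → ℝ} (hb : ∀ i j k, b i j - b i k ≤ 1) (hs : ∀ i, 0 ≤ s i) :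
    ∑ π : Equiv.Perm ι, Real.exp (∑ i, s i * (b i (π i) - (∑ k, b i k) / Fintype.card ι))
      ≤ Fintype.card (Equiv.Perm ι) * Real.exp (∑ i, s i ^ 2 / 4) := by
  set β : ι → ι → ℝ := fun i j => b i j - (∑ k, b i k) / Fintype.card ι with hβ
  -- Raise all coefficients together, freezing the `i`-th one when it reaches `s i`.
  set α : ℝ → ι → ι → ℝ := fun t i j => min t (s i) * β i j - min t (s i) ^ 2 / 4 with hαdef
  set f : ℝ → ℝ := fun t => ∑ π : Equiv.Perm ι, Real.exp (∑ i, α t i (π i)) with hf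
  set d : ℝ → ι → ℝ := fun t i => if t < s i then 1 else 0 with hd
  set T : ℝ := ∑ i, s i with hT
  have hT0 : 0 ≤ T := Finset.sum_nonneg fun i _ => hs i
  have hsT : ∀ i, s i ≤ T := fun i =>
    Finset.single_le_sum (fun i _ => hs i) (Finset.mem_univ i)
  have hcont : Continuous f := by
    simp only [hf, hαdef]
    fun_prop
  have hderiv : ∀ t, HasDerivWithinAt f (∑ π : Equiv.Perm ι, Real.exp (∑ i, α t i (π i)) *
      ∑ i, (d t i * β i (π i) - 2 * min t (s i) * d t i / 4)) (Set.Ici t) t := by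
    intro t
    refine HasDerivWithinAt.fun_sum fun π _ => HasDerivWithinAt.exp ?_
    refine HasDerivWithinAt.fun_sum fun i _ => ?_
    have hm := hasDerivWithinAt_min_const (s i) t
    have hm2 := (hm.fun_pow 2).div_const 4
    simp only [Nat.cast_ofNat, Nat.add_one_sub_one, pow_one] at hm2
    exact (hm.mul_const _).sub hm2
  have hbound : ∀ t, 0 ≤ t → ∑ π : Equiv.Perm ι, Real.exp (∑ i, α t i (π i)) *
      ∑ i, (d t i * β i (π i) - 2 * min t (s i) * d t i / 4) ≤ 0 := by
    intro t ht
    simp only [Finset.mul_sum]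
    rw [Finset.sum_comm]
    refine Finset.sum_nonpos fun i _ => ?_
    by_cases hi : t < s i
    · have hα : ∀ i j k, α t i j - α t i k ≤ t := by
        intro i j k
        have h0 : 0 ≤ min t (s i) := le_min ht (hs i)
        have h1 : min t (s i) * (b i j - b i k) ≤ min t (s i) * 1 :=
          mul_le_mul_of_nonneg_left (hb i j k) h0
        have h2 := min_le_left t (s i)
        simp only [hαdef, hβ]
        linarith
      have hkey := sum_exp_mul_sub_mean_le hα (hb i) i
      rw [Finset.mul_sum, ← sub_nonpos, ← Finset.sum_sub_distrib] at hkey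
      refine le_trans (le_of_eq (Finset.sum_congr rfl fun π _ => ?_)) hkey
      simp only [hd, if_pos hi, min_eq_left hi.le, hβ]
      ring
    · simp [hd, hi]
  have hfT : f T ≤ f 0 :=
    image_le_of_deriv_right_le_deriv_boundary (B := fun _ => f 0) (B' := fun _ => 0)
      hcont.continuousOn (fun t _ => hderiv t) le_rfl continuousOn_const
      (fun t _ => hasDerivWithinAt_const t _ _) (fun t ht => hbound t ht.1)
      (Set.right_mem_Icc.mpr hT0)
  have hf0 : f 0 = Fintype.card (Equiv.Perm ι) := by
    simp [hf, hαdef, min_eq_left (hs _)]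
  have hfTeq : f T = (∑ π : Equiv.Perm ι, Real.exp (∑ i, s i * β i (π i)))
      / Real.exp (∑ i, s i ^ 2 / 4) := by
    simp only [hf, hαdef, min_eq_right (hsT _), Finset.sum_sub_distrib, Real.exp_sub,
      Finset.sum_div]
  rwa [hf0, hfTeq, div_le_iff₀ (Real.exp_pos _)] at hfT

/-- A fixed entry of a uniform permutation is uniform. -/
lemma sum_perm_apply_div_card {ι : Type*} [Fintype ι] [DecidableEq ι] [Nonempty ι]
    (g : ι → ℝ) (i : ι) :
    (∑ π : Equiv.Perm ι, g (π i)) / Fintype.card (Equiv.Perm ι)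
      = (∑ k, g k) / Fintype.card ι := by
  have hswap : ∀ k, ∑ π : Equiv.Perm ι, g (π k) = ∑ π : Equiv.Perm ι, g (π i) := by
    intro k
    rw [← Equiv.sum_comp (Equiv.mulRight (Equiv.swap i k))]
    simp
  have hsum : ∑ k, ∑ π : Equiv.Perm ι, g (π k)
      = Fintype.card (Equiv.Perm ι) * ∑ k, g k := by
    rw [Finset.sum_comm]
    simp [Equiv.sum_comp]
  simp only [hswap, Finset.sum_const, Finset.card_univ, nsmul_eq_mul] at hsum
  rw [div_eq_div_iff (by positivity) (by positivity)]
  linarith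

/-- Exponential moment bound for the centred Hoeffding statistic with row ranges `c i`. -/
lemma sum_exp_mul_hoeffding_le {ι : Type*} [Fintype ι] [DecidableEq ι] [Nonempty ι]
    {a : ι → ι → ℝ} {c : ι → ℝ} (hc : ∀ i j k, a i j - a i k ≤ c i) {l : ℝ} (hl : 0 ≤ l) :
    ∑ π : Equiv.Perm ι, Real.exp (l * ∑ i, (a i (π i) - (∑ k, a i k) / Fintype.card ι))
      ≤ Fintype.card (Equiv.Perm ι) * Real.exp (l ^ 2 * (∑ i, c i ^ 2) / 4) := by
  have hc0 : ∀ i, 0 ≤ c i := fun i => by simpa using hc i i i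
  have hb : ∀ i j k, a i j / c i - a i k / c i ≤ 1 := fun i j k => by
    rw [← sub_div]
    exact div_le_one_of_le₀ (hc i j k) (hc0 i)
  have h := sum_exp_perm_le hb fun i => mul_nonneg hl (hc0 i)
  have hterm : ∀ i j, l * c i * (a i j / c i - (∑ k, a i k / c i) / Fintype.card ι)
      = l * (a i j - (∑ k, a i k) / Fintype.card ι) := by
    intro i j
    rcases eq_or_ne (c i) 0 with h0 | h0
    · have hconst : ∀ k, a i k = a i j := fun k =>
        le_antisymm (by linarith [hc i k j]) (by linarith [hc i j k])
      simp [h0, hconst]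
    · rw [← Finset.sum_div]
      field_simp
  simp only [hterm, ← Finset.mul_sum] at h
  refine h.trans_eq ?_
  congr 2
  simp only [Finset.mul_sum, Finset.sum_div, mul_pow]

/-- Sub-Gaussian concentration of the Hoeffding statistic `Y = Σ_i a_{i π(i)}`
for a uniformly random permutation `π`: for `t ≥ 0`,
`P(Y - E[Y] ≥ t) ≤ exp(-t² / Σ_i c_i²)`, where
`c_i = max_j a_{ij} - min_j a_{ij}`. -/
theorem hoeffding_statistic_concentration (n : ℕ) [NeZero n]
    (a : Fin n → Fin n → ℝ) (t : ℝ) (ht : 0 ≤ t) :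
    letI : MeasurableSpace (Equiv.Perm (Fin n)) := ⊤
    letI U : Measure (Equiv.Perm (Fin n)) :=
      (PMF.uniformOfFintype (Equiv.Perm (Fin n))).toMeasure
    (U {π | t ≤ (∑ i, a i (π i)) - ∫ π', ∑ i, a i (π' i) ∂U}).toReal ≤
      Real.exp (-(t ^ 2) /
        ∑ i, (Finset.univ.sup' Finset.univ_nonempty (a i) -
              Finset.univ.inf' Finset.univ_nonempty (a i)) ^ 2) := by
  classical
  let _ : MeasurableSpace (Equiv.Perm (Fin n)) := ⊤
  set U : Measure (Equiv.Perm (Fin n)) :=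
    (PMF.uniformOfFintype (Equiv.Perm (Fin n))).toMeasure
  set c : Fin n → ℝ := fun i => Finset.univ.sup' Finset.univ_nonempty (a i) -
    Finset.univ.inf' Finset.univ_nonempty (a i)
  have hc : ∀ i j k, a i j - a i k ≤ c i := fun i j k =>
    sub_le_sub (Finset.le_sup' (a i) (Finset.mem_univ j))
      (Finset.inf'_le (a i) (Finset.mem_univ k))
  set V := ∑ i, c i ^ 2
  have hV : 0 ≤ V := Finset.sum_nonneg fun i _ => sq_nonneg _
  set M : ℝ := (Fintype.card (Equiv.Perm (Fin n)) : ℝ)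
  have hM0 : 0 < M := Nat.cast_pos.mpr Fintype.card_pos
  have hmean : ∫ π', ∑ i, a i (π' i) ∂U = ∑ i, (∑ k, a i k) / Fintype.card (Fin n) := by
    rw [PMF.integral_eq_sum]
    simp only [PMF.uniformOfFintype_apply, ENNReal.toReal_inv, ENNReal.toReal_natCast, smul_eq_mul,
      ← Finset.mul_sum]
    rw [Finset.sum_comm, mul_comm, ← div_eq_mul_inv, Finset.sum_div]
    exact Finset.sum_congr rfl fun i _ => sum_perm_apply_div_card (a i) i
  set Z : Equiv.Perm (Fin n) → ℝ := fun π =>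
    ∑ i, (a i (π i) - (∑ k, a i k) / Fintype.card (Fin n)) with hZ
  have hset : {π : Equiv.Perm (Fin n) | t ≤ (∑ i, a i (π i)) - ∫ π', ∑ i, a i (π' i) ∂U}
      = {π | t ≤ Z π} := by
    rw [hmean]
    simp only [hZ, Finset.sum_sub_distrib]
  rw [hset, PMF.toMeasure_uniformOfFintype_apply _ MeasurableSpace.measurableSet_top,
    ENNReal.toReal_div, ENNReal.toReal_natCast, ENNReal.toReal_natCast, div_le_iff₀ hM0]
  set l := 2 * t / V with hl
  have hl0 : 0 ≤ l := by positivity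
  have hmarkov : (Fintype.card {π : Equiv.Perm (Fin n) | t ≤ Z π} : ℝ) * Real.exp (l * t)
      ≤ ∑ π, Real.exp (l * Z π) := by
    rw [Fintype.card_ofFinset, ← nsmul_eq_mul, ← Finset.sum_const]
    refine (Finset.sum_le_sum fun π hπ => ?_).trans
      (Finset.sum_le_sum_of_subset_of_nonneg (Finset.subset_univ _)
        fun π _ _ => (Real.exp_pos _).le)
    exact Real.exp_le_exp.mpr (mul_le_mul_of_nonneg_left (by simpa using hπ) hl0)
  have hmoment := hmarkov.trans (sum_exp_mul_hoeffding_le hc hl0)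
  rw [← le_div_iff₀ (Real.exp_pos _), mul_div_assoc, ← Real.exp_sub] at hmoment
  refine hmoment.trans_eq ?_
  rw [mul_comm]
  congr 2
  rcases eq_or_ne V 0 with h0 | h0
  · simp [hl, h0]
  · change l ^ 2 * V / 4 - l * t = -t ^ 2 / V
    rw [hl]
    field_simp
    ring
end

section
/- Let A = (a_{ij}) be an n × n real matrix, let π be a uniformly random permutation of {1, …, n}, set c_i = max_j a_{ij} − min_j a_{ij}, and let f : ℝⁿ → ℝ be L-Lipschitz with respect to the supremum norm on ℝⁿ. Then the random variable Z = f(a_{1π(1)}, …, a_{nπ(n)}) satisfies, for all t ≥ 0, P(Z − E[Z] ≥ t) ≤ exp(−t² / (L² Σ_{i=1}^n c_i²)). -/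
open MeasureTheory

open scoped BigOperators

/-- Integration against the uniform distribution on a finite type is averaging. -/
lemma integral_uniformOfFintype {α : Type*} [Fintype α] [Nonempty α] [MeasurableSpace α]
    [MeasurableSingletonClass α] (g : α → ℝ) :
    ∫ x, g x ∂(PMF.uniformOfFintype α).toMeasure = 𝔼 x, g x := by
  rw [PMF.integral_eq_sum, Fintype.expect_eq_sum_div_card, Finset.sum_div]
  refine Finset.sum_congr rfl fun x _ => ?_
  simp [div_eq_inv_mul]

/-- Hoeffding's lemma for the uniform distribution on a finite type. -/
lemma expect_exp_sub_expect_le {α : Type*} [Fintype α] [Nonempty α] (X : α → ℝ) (c s : ℝ)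
    (hX : ∀ x y, X x - X y ≤ c) :
    𝔼 x, Real.exp (s * (X x - 𝔼 y, X y)) ≤ Real.exp (s ^ 2 * c ^ 2 / 8) := by
  let _ : MeasurableSpace α := ⊤
  obtain ⟨m, hm⟩ := Finite.exists_min X
  have key := (ProbabilityTheory.hasSubgaussianMGF_of_mem_Icc (X := X)
    (μ := (PMF.uniformOfFintype α).toMeasure) (a := X m) (b := X m + c)
    (measurable_from_top.aemeasurable)
    (Filter.Eventually.of_forall fun x => ⟨hm x, by linarith [hX x m]⟩)).mgf_le s
  rw [ProbabilityTheory.mgf, integral_uniformOfFintype, integral_uniformOfFintype] at key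
  refine key.trans_eq (congrArg Real.exp ?_)
  have : (‖X m + c - X m‖ : ℝ) ^ 2 = c ^ 2 := by simp
  push_cast
  rw [div_pow, this]
  ring

open Equiv Equiv.Perm

lemma decomposeFin_symm_mul_swap {n : ℕ} (p : Fin (n + 1)) (e : Perm (Fin n)) (i j : Fin n) :
    decomposeFin.symm (p, e * swap i j) = decomposeFin.symm (p, e) * swap i.succ j.succ := by
  ext x
  refine Fin.cases ?_ (fun k => ?_) x
  · rw [mul_apply, swap_apply_of_ne_of_ne (Fin.succ_ne_zero _).symm (Fin.succ_ne_zero _).symm]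
    simp
  · rw [mul_apply, (Fin.succ_injective n).swap_apply]
    simp

lemma sum_decomposeFin_symm {n : ℕ} (g : Perm (Fin (n + 1)) → ℝ) (p : Fin (n + 1)) :
    ∑ e, g (decomposeFin.symm (p, e)) = ∑ σ, if σ 0 = p then g σ else 0 := by
  rw [← decomposeFin.symm.sum_comp, Fintype.sum_prod_type_right]
  simp

lemma expect_perm_fin_succ {n : ℕ} (g : Perm (Fin (n + 1)) → ℝ) :
    𝔼 σ, g σ = 𝔼 p, 𝔼 e, g (decomposeFin.symm (p, e)) := by
  rw [← Finset.expect_product', Finset.univ_product_univ]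
  exact (Fintype.expect_equiv decomposeFin.symm _ _ fun _ => rfl).symm

/-- Moving the value at `0` from `q` to `p` changes conditional means by at most the effect of one
transposition involving `0`. -/
lemma expect_decomposeFin_symm_sub_le {n : ℕ} (g : Perm (Fin (n + 1)) → ℝ) (c : ℝ)
    (hg : ∀ σ j, g (σ * swap 0 j) - g σ ≤ c) (p q : Fin (n + 1)) :
    𝔼 e, g (decomposeFin.symm (p, e)) - 𝔼 e, g (decomposeFin.symm (q, e)) ≤ c := by
  have hp : 𝔼 e, g (decomposeFin.symm (p, e))
      = 𝔼 e, g (swap q p * decomposeFin.symm (q, e)) := by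
    rw [Fintype.expect_eq_sum_div_card, Fintype.expect_eq_sum_div_card, sum_decomposeFin_symm,
      sum_decomposeFin_symm (fun σ => g (swap q p * σ)),
      ← Equiv.sum_comp (Equiv.mulLeft (swap q p))]
    simp [swap_apply_eq_iff]
  rw [hp, ← Finset.expect_sub_distrib]
  refine Finset.expect_le Finset.univ_nonempty fun e _ => ?_
  have h := hg (decomposeFin.symm (q, e)) ((decomposeFin.symm (q, e))⁻¹ p)
  rwa [mul_swap_eq_swap_mul, decomposeFin_symm_apply_zero, ← mul_apply, mul_inv_cancel, one_apply] at h

/-- Sub-Gaussian moment generating function for functions on the symmetric group with transposition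
increments bounded according to the first transposed index. -/
lemma expect_exp_perm_le {n : ℕ} (g : Perm (Fin n) → ℝ) (c : Fin n → ℝ)
    (hg : ∀ σ i j, i ≤ j → g (σ * swap i j) - g σ ≤ c i) (s : ℝ) :
    𝔼 σ, Real.exp (s * (g σ - 𝔼 τ, g τ)) ≤ Real.exp (s ^ 2 * (∑ i, c i ^ 2) / 8) := by
  induction n with
  | zero => simp
  | succ n ih =>
    set m : Fin (n + 1) → ℝ := fun p => 𝔼 e, g (decomposeFin.symm (p, e))
    have hmean : 𝔼 τ, g τ = 𝔼 p, m p := expect_perm_fin_succ g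
    have hcond (p : Fin (n + 1)) : 𝔼 e, Real.exp (s * (g (decomposeFin.symm (p, e)) - m p))
        ≤ Real.exp (s ^ 2 * (∑ i : Fin n, c i.succ ^ 2) / 8) := by
      refine ih (fun e => g (decomposeFin.symm (p, e))) (fun i => c i.succ) fun e i j hij => ?_
      rw [decomposeFin_symm_mul_swap]
      exact hg _ _ _ (Fin.succ_le_succ_iff.mpr hij)
    have hfirst : 𝔼 p, Real.exp (s * (m p - 𝔼 q, m q)) ≤ Real.exp (s ^ 2 * c 0 ^ 2 / 8) :=
      expect_exp_sub_expect_le m (c 0) s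
        (expect_decomposeFin_symm_sub_le g (c 0) fun σ j => hg σ 0 j (Fin.zero_le j))
    rw [expect_perm_fin_succ, hmean]
    calc 𝔼 p, 𝔼 e, Real.exp (s * (g (decomposeFin.symm (p, e)) - 𝔼 q, m q))
        = 𝔼 p, Real.exp (s * (m p - 𝔼 q, m q)) *
            𝔼 e, Real.exp (s * (g (decomposeFin.symm (p, e)) - m p)) := by
          refine Finset.expect_congr rfl fun p _ => ?_
          rw [Finset.mul_expect]
          refine Finset.expect_congr rfl fun e _ => ?_
          rw [← Real.exp_add]
          ring_nf
      _ ≤ 𝔼 p, Real.exp (s * (m p - 𝔼 q, m q)) *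
            Real.exp (s ^ 2 * (∑ i : Fin n, c i.succ ^ 2) / 8) :=
          Finset.expect_le_expect fun p _ =>
            mul_le_mul_of_nonneg_left (hcond p) (Real.exp_pos _).le
      _ ≤ Real.exp (s ^ 2 * c 0 ^ 2 / 8) *
            Real.exp (s ^ 2 * (∑ i : Fin n, c i.succ ^ 2) / 8) := by
          rw [← Finset.expect_mul]
          exact mul_le_mul_of_nonneg_right hfirst (Real.exp_pos _).le
      _ = Real.exp (s ^ 2 * (∑ i, c i ^ 2) / 8) := by
          rw [← Real.exp_add, Fin.sum_univ_succ]
          ring_nf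

/-- Swapping the columns assigned to two rows changes a sup-norm Lipschitz statistic by at most
`L` times the larger of the two row oscillations. -/
lemma lipschitz_perm_swap_sub_le {n : ℕ} [NeZero n] (a : Fin n → Fin n → ℝ) (L : ℝ) (hL : 0 < L)
    (f : (Fin n → ℝ) → ℝ)
    (hf : ∀ x y : Fin n → ℝ,
      |f x - f y| ≤ L * Finset.univ.sup' Finset.univ_nonempty (fun i => |x i - y i|))
    (osc : Fin n → ℝ) (hosc : ∀ i j k, |a i j - a i k| ≤ osc i)
    (π : Perm (Fin n)) (k l : Fin n) (hkl : osc l ≤ osc k) :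
    f (fun i => a i ((π * swap k l) i)) - f (fun i => a i (π i)) ≤ L * osc k := by
  refine (le_abs_self _).trans ((hf _ _).trans (mul_le_mul_of_nonneg_left ?_ hL.le))
  refine Finset.sup'_le _ _ fun i _ => ?_
  by_cases hik : i = k
  · subst hik; exact hosc _ _ _
  by_cases hil : i = l
  · subst hil; exact (hosc _ _ _).trans hkl
  · rw [mul_apply, swap_apply_of_ne_of_ne hik hil, sub_self, abs_zero]
    exact (abs_nonneg _).trans (hosc k k k)

/-- Sub-Gaussian concentration for `Z = f(a_{1π(1)}, …, a_{nπ(n)})` where `π` is a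
uniformly random permutation and `f` is `L`-Lipschitz for the supremum norm:
for `t ≥ 0`, `P(Z - E[Z] ≥ t) ≤ exp(-t² / (L² Σ_i c_i²))`, where
`c_i = max_j a_{ij} - min_j a_{ij}`. -/
theorem hoeffding_lipschitz_concentration (n : ℕ) [NeZero n]
    (a : Fin n → Fin n → ℝ) (L : ℝ) (hL : 0 < L) (f : (Fin n → ℝ) → ℝ)
    (hf : ∀ x y : Fin n → ℝ,
      |f x - f y| ≤ L * Finset.univ.sup' Finset.univ_nonempty (fun i => |x i - y i|))
    (t : ℝ) (ht : 0 ≤ t) :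
    letI : MeasurableSpace (Equiv.Perm (Fin n)) := ⊤
    letI U : Measure (Equiv.Perm (Fin n)) :=
      (PMF.uniformOfFintype (Equiv.Perm (Fin n))).toMeasure
    (U {π | t ≤ f (fun i => a i (π i)) - ∫ π', f (fun i => a i (π' i)) ∂U}).toReal ≤
      Real.exp (-(t ^ 2) /
        (L ^ 2 * ∑ i, (Finset.univ.sup' Finset.univ_nonempty (a i) -
              Finset.univ.inf' Finset.univ_nonempty (a i)) ^ 2)) := by
  let _ : MeasurableSpace (Perm (Fin n)) := ⊤
  set U : Measure (Perm (Fin n)) := (PMF.uniformOfFintype (Perm (Fin n))).toMeasure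
  set osc : Fin n → ℝ := fun i => Finset.univ.sup' Finset.univ_nonempty (a i) -
    Finset.univ.inf' Finset.univ_nonempty (a i)
  have hosc (i j k : Fin n) : |a i j - a i k| ≤ osc i := by
    have hle (x : Fin n) := Finset.le_sup' (a i) (Finset.mem_univ x)
    have hge (x : Fin n) := Finset.inf'_le (a i) (Finset.mem_univ x)
    rw [abs_le]
    constructor <;> linarith [hle j, hge j, hle k, hge k]
  set Z : Perm (Fin n) → ℝ := fun π => f fun i => a i (π i)
  -- Reveal the rows in order of decreasing oscillation.
  obtain ⟨ρ, hρ⟩ : ∃ ρ : Perm (Fin n), Antitone (osc ∘ ρ) :=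
    ⟨Tuple.sort fun i => -osc i, fun i j hij =>
      neg_le_neg_iff.mp (Tuple.monotone_sort (fun i => -osc i) hij)⟩
  have hreindex (h : Perm (Fin n) → ℝ) : 𝔼 σ, h (σ * ρ⁻¹) = 𝔼 π, h π :=
    Fintype.expect_equiv (Equiv.mulRight ρ⁻¹) _ _ fun _ => rfl
  have hmgf (s : ℝ) : 𝔼 π, Real.exp (s * (Z π - 𝔼 τ, Z τ))
      ≤ Real.exp (s ^ 2 * (∑ i, (L * osc i) ^ 2) / 8) := by
    have h := expect_exp_perm_le (fun σ => Z (σ * ρ⁻¹)) (fun i => L * osc (ρ i))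
      (fun σ i j hij => by
        have hswap : σ * swap i j * ρ⁻¹ = σ * ρ⁻¹ * swap (ρ i) (ρ j) := by
          rw [mul_assoc, mul_assoc, swap_mul_eq_mul_swap, inv_inv]
        simp only [hswap]
        exact lipschitz_perm_swap_sub_le a L hL f hf osc hosc _ _ _ (hρ hij)) s
    rwa [hreindex Z, hreindex (fun π => Real.exp (s * (Z π - 𝔼 τ, Z τ))),
      Equiv.sum_comp ρ fun i => (L * osc i) ^ 2] at h
  have hD : L ^ 2 * ∑ i, osc i ^ 2 = ∑ i, (L * osc i) ^ 2 := by
    simp_rw [mul_pow, Finset.mul_sum]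
  have hD0 : 0 ≤ ∑ i, (L * osc i) ^ 2 := Finset.sum_nonneg fun i _ => sq_nonneg _
  have hsub : ProbabilityTheory.HasSubgaussianMGF (fun π => Z π - ∫ τ, Z τ ∂U)
      (NNReal.mk ((∑ i, (L * osc i) ^ 2) / 4) (by positivity)) U := by
    refine ⟨fun s => Integrable.of_finite, fun s => ?_⟩
    rw [ProbabilityTheory.mgf, integral_uniformOfFintype, integral_uniformOfFintype]
    refine (hmgf s).trans_eq (congrArg Real.exp ?_)
    simp only [NNReal.coe_mk]
    ring
  refine (hsub.measure_ge_le ht).trans (Real.exp_le_exp.mpr ?_)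
  rw [hD, NNReal.coe_mk, neg_div, neg_div, neg_le_neg_iff]
  rcases hD0.eq_or_lt with h0 | hpos
  · simp [← h0]
  · exact div_le_div_of_nonneg_left (sq_nonneg t) (by positivity) (by linarith)
end
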